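/- Let G be a finite simple graph on n vertices, and let R and R' be finite simple graphs on r and r' vertices respectively. Then n · Σ_{v ∈ V(G)} X_R(G∖v) · X_{R'}(G∖v) − (Σ_{v ∈ V(G)} X_R(G∖v)) · (Σ_{v ∈ V(G)} X_{R'}(G∖v)) = Σ_{(S_1, S_2)} (n · |V(S_1) ∩ V(S_2)| − r·r'), where the right-hand sum is over all ordered pairs (S_1, S_2) with S_1 a copy of R in G and S_2 a copy of R' in G, and G∖v denotes the induced subgraph of G on V(G)∖{v}. (Equivalently, n² times the covariance, over a uniformly random vertex V of G, of X_R(G∖V) and X_{R'}(G∖V) equals the right-hand side.) -/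

import Mathlib

open SimpleGraph Finset

/-- `XCount R G` is the number of copies of `R` in `G`, i.e. the number of subgraphs of `G`
isomorphic to `R`. -/
noncomputable def XCount {α β : Type*} (R : SimpleGraph α) (G : SimpleGraph β) : ℕ :=
  Nat.card {S : G.Subgraph // Nonempty (S.coe ≃g R)}

lemma XCount_induce {V α : Type*} (G : SimpleGraph V) (R : SimpleGraph α) (s : Set V) :
    XCount R (G.induce s) =
      Nat.card {S : {S : G.Subgraph // Nonempty (S.coe ≃g R)} // S.1.verts ⊆ s} := by
  have hiso : ∀ T : (G.induce s).Subgraph,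
      Nonempty (T.coe ≃g (T.map (Embedding.induce s).toHom).coe) := by
    intro T
    refine ⟨⟨Equiv.ofBijective
      (fun x => ⟨x.1.1, ⟨x.1, x.2, rfl⟩⟩) ⟨?_, ?_⟩, ?_⟩⟩
    · intro x y h
      exact Subtype.ext (Subtype.ext (by have h2 := congrArg Subtype.val h; exact h2))
    · rintro ⟨_, x, hx, rfl⟩
      exact ⟨⟨x, hx⟩, rfl⟩
    · rintro ⟨x, hx⟩ ⟨y, hy⟩
      simp only [Subgraph.coe_adj, Subgraph.map_adj, Relation.Map]
      constructor
      · rintro ⟨a, b, hab, ha, hb⟩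
        have h1 : a = x := Subtype.ext ha
        have h2 : b = y := Subtype.ext hb
        rw [← h1, ← h2]; exact hab
      · intro h
        exact ⟨x, y, h, rfl, rfl⟩
  unfold XCount
  refine Nat.card_congr (Equiv.ofBijective
    (fun T => ⟨⟨T.1.map (Embedding.induce s).toHom, ?_⟩, ?_⟩) ⟨?_, ?_⟩)
  · obtain ⟨e⟩ := hiso T.1
    obtain ⟨f⟩ := T.2
    exact ⟨e.symm.trans f⟩
  · rintro _ ⟨x, hx, rfl⟩
    exact x.2
  · intro T T' h
    have h' := congrArg (fun z => z.1.1) h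
    have key : ∀ T : (G.induce s).Subgraph,
        (T.map (Embedding.induce (G := G) s).toHom).comap
          (Embedding.induce (G := G) s).toHom = T := by
      intro T
      ext x y
      · constructor
        · rintro ⟨a, ha, hax⟩
          have h1 : a = x := Subtype.ext hax
          exact h1 ▸ ha
        · intro hx; exact ⟨x, hx, rfl⟩
      · constructor
        · rintro ⟨_, a, b, hab, hax, hby⟩
          have h1 : a = x := Subtype.ext hax
          have h2 : b = y := Subtype.ext hby
          rw [← h1, ← h2]; exact hab
        · intro h
          exact ⟨T.adj_sub h, x, y, h, rfl, rfl⟩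
    refine Subtype.ext ?_
    rw [← key T.1, ← key T'.1]
    exact congrArg _ h'
  · rintro ⟨⟨S, hS⟩, hs⟩
    have key : (S.comap (Embedding.induce (G := G) s).toHom).map
        (Embedding.induce (G := G) s).toHom = S := by
      ext x y
      · constructor
        · rintro ⟨a, ha, rfl⟩; exact ha
        · intro hx; exact ⟨⟨x, hs hx⟩, hx, rfl⟩
      · constructor
        · rintro ⟨a, b, hab, rfl, rfl⟩; exact hab.2
        · intro h
          exact ⟨⟨x, hs h.fst_mem⟩, ⟨y, hs h.snd_mem⟩, ⟨S.adj_sub h, h⟩, rfl, rfl⟩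
    refine ⟨⟨S.comap (Embedding.induce (G := G) s).toHom, ?_⟩, ?_⟩
    · obtain ⟨e⟩ := hiso (S.comap (Embedding.induce (G := G) s).toHom)
      rw [key] at e
      obtain ⟨f⟩ := hS
      exact ⟨e.trans f⟩
    · exact Subtype.ext (Subtype.ext key)

open Classical in
lemma XCount_erase {V α : Type*} [Fintype V] (G : SimpleGraph V)
    (R : SimpleGraph α) [Fintype {S : G.Subgraph // Nonempty (S.coe ≃g R)}] (s : Set V) (v : V)
    (hs : ∀ x, x ∈ s ↔ x ≠ v) :
    (XCount R (G.induce s) : ℤ) =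
      ∑ S : {S : G.Subgraph // Nonempty (S.coe ≃g R)}, (1 - if v ∈ S.1.verts then 1 else 0) := by
  rw [XCount_induce, Nat.card_eq_fintype_card, Fintype.card_subtype, Finset.card_filter]
  push_cast
  refine Finset.sum_congr rfl fun S _ => ?_
  have : S.1.verts ⊆ s ↔ v ∉ S.1.verts := by
    constructor
    · intro h hv; exact (hs v).1 (h hv) rfl
    · intro h x hx; exact (hs x).2 (fun e => h (e ▸ hx))
  by_cases h : v ∈ S.1.verts <;> simp [this, h]

lemma sum_verts {V : Type*} [Fintype V] (A : Set V) [DecidablePred (· ∈ A)] :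
    ∑ v : V, (if v ∈ A then (1 : ℤ) else 0) = Nat.card A := by
  rw [Nat.card_eq_fintype_card, Fintype.card_subtype, Finset.card_filter]
  push_cast; rfl

lemma card_copy {V α : Type*} [Fintype α] {G : SimpleGraph V}
    {R : SimpleGraph α} (S : {S : G.Subgraph // Nonempty (S.coe ≃g R)}) :
    Nat.card S.1.verts = Fintype.card α := by
  obtain ⟨e⟩ := S.2
  rw [← Nat.card_eq_fintype_card]
  exact Nat.card_congr e.toEquiv

/-- `n · Σ_v X_R(G∖v)·X_{R'}(G∖v) − (Σ_v X_R(G∖v))·(Σ_v X_{R'}(G∖v))` equals the sum, over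
all ordered pairs `(S₁, S₂)` of a copy of `R` and a copy of `R'` in `G`, of
`n · |V(S₁) ∩ V(S₂)| − r·r'`. -/
theorem stmt_12 {V α β : Type*} [Fintype V] [DecidableEq V] [Fintype α] [Fintype β]
    (G : SimpleGraph V) (R : SimpleGraph α) (R' : SimpleGraph β) (n r r' : ℕ)
    (hn : Fintype.card V = n) (hr : Fintype.card α = r) (hr' : Fintype.card β = r') :
    (n : ℤ) * ∑ v : V, (XCount R (G.induce ↑(Finset.univ.erase v)) : ℤ)
          * (XCount R' (G.induce ↑(Finset.univ.erase v)) : ℤ)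
      - (∑ v : V, (XCount R (G.induce ↑(Finset.univ.erase v)) : ℤ))
          * (∑ v : V, (XCount R' (G.induce ↑(Finset.univ.erase v)) : ℤ))
      = ∑ᶠ (S₁ : {S : G.Subgraph // Nonempty (S.coe ≃g R)})
          (S₂ : {S : G.Subgraph // Nonempty (S.coe ≃g R')}),
          ((n : ℤ) * (Nat.card ↥(S₁.1.verts ∩ S₂.1.verts) : ℤ) - (r : ℤ) * (r' : ℤ)) := by
  classical
  have : Finite G.Subgraph := inferInstance
  let _ := Fintype.ofFinite {S : G.Subgraph // Nonempty (S.coe ≃g R)}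
  let _ := Fintype.ofFinite {S : G.Subgraph // Nonempty (S.coe ≃g R')}
  have hX := fun v : V => XCount_erase G R (↑(Finset.univ.erase v) : Set V) v (by simp)
  have hX' := fun v : V => XCount_erase G R' (↑(Finset.univ.erase v) : Set V) v (by simp)
  simp only [hX, hX', finsum_eq_sum_of_fintype]
  have hc : ∑ v : V, (1 : ℤ) = n := by simp [hn]
  have e1 : ∑ v : V, ∑ S : {S : G.Subgraph // Nonempty (S.coe ≃g R)},
      ((1 : ℤ) - if v ∈ S.1.verts then 1 else 0) =
      ∑ S : {S : G.Subgraph // Nonempty (S.coe ≃g R)}, ((n : ℤ) - r) := by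
    rw [Finset.sum_comm]
    refine Finset.sum_congr rfl fun S _ => ?_
    rw [Finset.sum_sub_distrib, sum_verts, card_copy, hc, hr]
  have e2 : ∑ v : V, ∑ S : {S : G.Subgraph // Nonempty (S.coe ≃g R')},
      ((1 : ℤ) - if v ∈ S.1.verts then 1 else 0) =
      ∑ S : {S : G.Subgraph // Nonempty (S.coe ≃g R')}, ((n : ℤ) - r') := by
    rw [Finset.sum_comm]
    refine Finset.sum_congr rfl fun S _ => ?_
    rw [Finset.sum_sub_distrib, sum_verts, card_copy, hc, hr']
  rw [e1, e2]
  simp only [Finset.sum_mul_sum]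
  rw [Finset.sum_comm, Finset.mul_sum, ← Finset.sum_sub_distrib]
  refine Finset.sum_congr rfl fun S _ => ?_
  rw [Finset.sum_comm, Finset.mul_sum, ← Finset.sum_sub_distrib]
  refine Finset.sum_congr rfl fun T _ => ?_
  have h3 : ∑ v : V, ((1 : ℤ) - if v ∈ S.1.verts then 1 else 0) *
      (1 - if v ∈ T.1.verts then 1 else 0) =
      n - r - r' + Nat.card ↥(S.1.verts ∩ T.1.verts) := by
    have : ∀ v : V, ((1 : ℤ) - if v ∈ S.1.verts then 1 else 0) *
      (1 - if v ∈ T.1.verts then 1 else 0) = 1 - (if v ∈ S.1.verts then 1 else 0)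
        - (if v ∈ T.1.verts then 1 else 0) + (if v ∈ S.1.verts ∩ T.1.verts then 1 else 0) := by
      intro v
      by_cases h1 : v ∈ S.1.verts <;> by_cases h2 : v ∈ T.1.verts <;> simp [h1, h2]
    simp only [this]
    rw [Finset.sum_add_distrib, Finset.sum_sub_distrib, Finset.sum_sub_distrib, sum_verts,
      sum_verts, sum_verts, card_copy, card_copy, hc, hr, hr']
  rw [h3]
  ring
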